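/- For every integer v ≥ 67 with v ≡ 7 (mod 12), there exists a 2-(v,4,1) directed design (which has v(v−1)/6 blocks) whose smallest defining sets contain at least (5/8 − 13/(8v) − 21/(2v(v−1)))·(v(v−1)/6) blocks. -/

import Mathlib

open scoped Classical

/-- A block of size `k` on the point set `α`: a list of `k` distinct points. -/
def IsBlock {α : Type*} (k : ℕ) (b : List α) : Prop :=
  b.Nodup ∧ b.length = k

/-- A `t-(v,k,λ)` directed design whose point set is the whole (finite) type `α`
(so `v = Fintype.card α`): every ordered `t`-tuple of distinct points appears,
as a subsequence, in exactly `lam` blocks of the multiset `B`. -/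
def IsDD {α : Type*} (t k lam : ℕ) (B : Multiset (List α)) : Prop :=
  (∀ b ∈ B, IsBlock k b) ∧
    ∀ s : List α, s.Nodup → s.length = t →
      B.countP (fun b => s.Sublist b) = lam

/-- `S` is a defining set of the `t-(v,k,λ)` directed design with block multiset `B`:
`S` is a sub-multiset of `B`, and `B` is the unique block multiset of a
`t-(v,k,λ)DD` on the same point set containing `S`. -/
def IsDefiningSet {α : Type*} (t k lam : ℕ) (B S : Multiset (List α)) : Prop :=
  S ≤ B ∧ ∀ B' : Multiset (List α), IsDD t k lam B' → S ≤ B' → B' = B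

/-- A `(v,k,t)` directed trade `T₁ - T₂` of volume `s` on the point set `α`. -/
def IsTrade {α : Type*} (t k s : ℕ) (T₁ T₂ : Multiset (List α)) : Prop :=
  1 ≤ s ∧ Multiset.card T₁ = s ∧ Multiset.card T₂ = s ∧
    (∀ b ∈ T₁, IsBlock k b) ∧ (∀ b ∈ T₂, IsBlock k b) ∧
    (∀ b, b ∈ T₁ → b ∉ T₂) ∧
    ∀ l : List α, l.Nodup → l.length = t →
      T₁.countP (fun b => l.Sublist b) = T₂.countP (fun b => l.Sublist b)

/-- A multiset of blocks is super-simple if any two blocks (any sub-multiset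
consisting of two blocks) intersect, as point sets, in at most two points. -/
def SuperSimple {α : Type*} (B : Multiset (List α)) : Prop :=
  ∀ b₁ b₂ : List α, ({b₁, b₂} : Multiset (List α)) ≤ B →
    (b₁.toFinset ∩ b₂.toFinset).card ≤ 2

/-- A `2-(v,K,1)` design (pairwise balanced design) on the point type `β`. -/
def IsPBD {β : Type*} (K : Set ℕ) (D : Multiset (Finset β)) : Prop :=
  (∀ b ∈ D, b.card ∈ K) ∧
    ∀ x y : β, x ≠ y → D.countP (fun b => x ∈ b ∧ y ∈ b) = 1

/-- A `{K}`-GDD on the point type `β` with group multiset `Gs` and block multiset `Bs`. -/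
def IsGDD {β : Type*} (K : Set ℕ) (Gs Bs : Multiset (Finset β)) : Prop :=
  (∀ x : β, Gs.countP (fun G => x ∈ G) = 1) ∧
    (∀ b ∈ Bs, b.card ∈ K) ∧
    (∀ b ∈ Bs, ∀ G ∈ Gs, (b ∩ G).card ≤ 1) ∧
    (∀ x y : β, x ≠ y → (∀ G ∈ Gs, ¬(x ∈ G ∧ y ∈ G)) →
      Bs.countP (fun b => x ∈ b ∧ y ∈ b) = 1)

/-- A `4`-DGDD on the point type `β` with group multiset `Gs` and block multiset `B`:
the groups partition the points, no block meets a group twice, and every ordered pair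
of points from distinct groups appears in exactly one block. -/
def IsDGDD {β : Type*} (Gs : Multiset (Finset β)) (B : Multiset (List β)) : Prop :=
  (∀ x : β, Gs.countP (fun G => x ∈ G) = 1) ∧
    (∀ b ∈ B, IsBlock 4 b) ∧
    (∀ b ∈ B, ∀ G ∈ Gs, (b.toFinset ∩ G).card ≤ 1) ∧
    (∀ x y : β, x ≠ y → (∀ G ∈ Gs, ¬(x ∈ G ∧ y ∈ G)) →
      B.countP (fun b => [x, y].Sublist b) = 1)

/-- `S` is a defining set of the `4`-DGDD with groups `Gs` and block multiset `B`. -/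
def IsDGDDDefiningSet {β : Type*} (Gs : Multiset (Finset β)) (B S : Multiset (List β)) : Prop :=
  S ≤ B ∧ ∀ B' : Multiset (List β), IsDGDD Gs B' → S ≤ B' → B' = B

/-- The ordered pairs `(x, y)` such that `x` occurs before `y` in a list. -/
def orderedPairs {α : Type*} : List α → List (α × α)
  | [] => []
  | a :: l => l.map (Prod.mk a) ++ orderedPairs l

/-- The pairs of consecutive entries of a list. -/
def adjacentPairs {α : Type*} (l : List α) : List (α × α) :=
  l.zip l.tail

/-- Two blocks are swappable if some pair of points is adjacent in both, in opposite orders. -/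
def Swappable {α : Type*} (b c : List α) : Prop :=
  ∃ p ∈ adjacentPairs b, p.swap ∈ adjacentPairs c

/-- The directed pairs `(x, y)` with `P x y` can be partitioned into directed blocks of size four
in such a way that at least `N` blocks are needed to meet every pair of swappable blocks. -/
def HasDecomposition {α : Type*} (P : α → α → Prop) (N : ℕ) : Prop :=
  ∃ B : Finset (List α), (∀ b ∈ B, IsBlock 4 b) ∧
    (∀ b ∈ B, ∀ p ∈ orderedPairs b, P p.1 p.2) ∧
    (∀ x y, P x y → ∃! b, b ∈ B ∧ (x, y) ∈ orderedPairs b) ∧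
    ∀ S ⊆ B, (∀ b ∈ B, ∀ c ∈ B, Swappable b c → b ∈ S ∨ c ∈ S) → N ≤ S.card

theorem mem_orderedPairs {α : Type*} {x y : α} {l : List α} :
    (x, y) ∈ orderedPairs l ↔ [x, y].Sublist l := by
  induction l with
  | nil => simp [orderedPairs]
  | cons a l ih =>
    simp only [orderedPairs, List.mem_append, List.mem_map, Prod.mk.injEq, ih,
      List.cons_sublist_cons', List.singleton_sublist]
    constructor
    · rintro (⟨z, hz, rfl, rfl⟩ | h)
      · exact Or.inr ⟨rfl, hz⟩
      · exact Or.inl h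
    · rintro (h | ⟨rfl, h⟩)
      · exact Or.inr h
      · exact Or.inl ⟨y, h, rfl, rfl⟩

theorem orderedPairs_map {α β : Type*} (f : α → β) (l : List α) :
    orderedPairs (l.map f) = (orderedPairs l).map (Prod.map f f) := by
  induction l with
  | nil => rfl
  | cons a l ih => simp [orderedPairs, ih, Function.comp_def]

theorem adjacentPairs_map {α β : Type*} (f : α → β) (l : List α) :
    adjacentPairs (l.map f) = (adjacentPairs l).map (Prod.map f f) := by
  simp [adjacentPairs, ← List.map_tail, List.zip_map]

theorem exists_eq_append_of_mem_adjacentPairs {α : Type*} {x y : α} {l : List α}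
    (h : (x, y) ∈ adjacentPairs l) : ∃ u w, l = u ++ x :: y :: w := by
  induction l with
  | nil => simp [adjacentPairs] at h
  | cons a l ih =>
    cases l with
    | nil => simp [adjacentPairs] at h
    | cons c l =>
      have h' : (x, y) = (a, c) ∨ (x, y) ∈ adjacentPairs (c :: l) := by
        simpa [adjacentPairs] using h
      rcases h' with h' | h'
      · obtain ⟨rfl, rfl⟩ := Prod.mk.inj h'
        exact ⟨[], l, rfl⟩
      · obtain ⟨u, w, hu⟩ := ih h'
        exact ⟨a :: u, w, by rw [hu]; rfl⟩

theorem Swappable.map {α β : Type*} (f : α → β) {b c : List α} (h : Swappable b c) :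
    Swappable (b.map f) (c.map f) := by
  obtain ⟨p, hp, hq⟩ := h
  refine ⟨Prod.map f f p, ?_, ?_⟩
  · rw [adjacentPairs_map]
    exact List.mem_map_of_mem hp
  · rw [adjacentPairs_map]
    exact List.mem_map.2 ⟨p.swap, hq, rfl⟩

theorem Swappable.symm {α : Type*} {b c : List α} (h : Swappable b c) :
    Swappable c b := by
  obtain ⟨p, hp, hq⟩ := h
  exact ⟨p.swap, hq, by simpa using hp⟩

theorem IsBlock.map {α β : Type*} {k : ℕ} {f : α → β} (hf : Function.Injective f) {b : List α}
    (h : IsBlock k b) : IsBlock k (b.map f) :=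
  ⟨h.1.map hf, by simpa using h.2⟩

theorem IsBlock.exists_mem_orderedPairs {α : Type*} {b : List α} (h : IsBlock 4 b) :
    ∃ p, p ∈ orderedPairs b := by
  obtain ⟨a, c, d, e, rfl⟩ := List.length_eq_four.1 h.2
  exact ⟨(a, c), by simp [orderedPairs]⟩

theorem IsBlock.length_orderedPairs {α : Type*} {b : List α} (h : IsBlock 4 b) :
    (orderedPairs b).length = 6 := by
  obtain ⟨a, c, d, e, rfl⟩ := List.length_eq_four.1 h.2
  rfl

namespace HasDecomposition

theorem congr {α : Type*} {P Q : α → α → Prop} {M N : ℕ} (h : HasDecomposition P N)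
    (hPQ : ∀ x y, P x y ↔ Q x y) (hMN : M ≤ N) : HasDecomposition Q M := by
  obtain rfl : P = Q := by
    funext x y
    exact propext (hPQ x y)
  obtain ⟨B, h1, h2, h3, h4⟩ := h
  exact ⟨B, h1, h2, h3, fun S hS hc => hMN.trans (h4 S hS hc)⟩

theorem of_isEmpty {α : Type*} : HasDecomposition (fun _ _ : α => False) 0 :=
  ⟨∅, by simp, by simp, by simp, by simp⟩

theorem iUnion {α ι : Type*} [Fintype ι] {P : ι → α → α → Prop} {N : ι → ℕ}
    (h : ∀ i, HasDecomposition (P i) (N i)) (hP : ∀ i j x y, P i x y → P j x y → i = j) :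
    HasDecomposition (fun x y => ∃ i, P i x y) (∑ i, N i) := by
  choose B h1 h2 h3 h4 using h
  have hdisj : ∀ i j b, b ∈ B i → b ∈ B j → i = j := by
    intro i j b hi hj
    obtain ⟨p, hp⟩ := (h1 i b hi).exists_mem_orderedPairs
    exact hP i j _ _ (h2 i b hi p hp) (h2 j b hj p hp)
  refine ⟨Finset.univ.biUnion B, ?_, ?_, ?_, ?_⟩
  · intro b hb
    obtain ⟨i, -, hi⟩ := Finset.mem_biUnion.1 hb
    exact h1 i b hi
  · intro b hb p hp
    obtain ⟨i, -, hi⟩ := Finset.mem_biUnion.1 hb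
    exact ⟨i, h2 i b hi p hp⟩
  · rintro x y ⟨i, hi⟩
    obtain ⟨b, ⟨hb, hxy⟩, hu⟩ := h3 i x y hi
    refine ⟨b, ⟨Finset.mem_biUnion.2 ⟨i, Finset.mem_univ _, hb⟩, hxy⟩, ?_⟩
    rintro c ⟨hc, hc'⟩
    obtain ⟨j, -, hj⟩ := Finset.mem_biUnion.1 hc
    obtain rfl := hP i j x y hi (h2 j c hj _ hc')
    exact hu c ⟨hj, hc'⟩
  · intro S _ hS
    calc ∑ i, N i ≤ ∑ i, (S ∩ B i).card := by
          refine Finset.sum_le_sum fun i _ => h4 i _ Finset.inter_subset_right ?_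
          intro b hb c hc hbc
          simpa [hb, hc] using hS b (Finset.mem_biUnion.2 ⟨i, Finset.mem_univ _, hb⟩) c
            (Finset.mem_biUnion.2 ⟨i, Finset.mem_univ _, hc⟩) hbc
      _ = (Finset.univ.biUnion fun i => S ∩ B i).card := by
          refine (Finset.card_biUnion ?_).symm
          intro i _ j _ hij
          refine Finset.disjoint_left.2 fun b hb hb' => hij ?_
          exact hdisj i j b (Finset.mem_inter.1 hb).2 (Finset.mem_inter.1 hb').2
      _ ≤ S.card := by
          refine Finset.card_le_card fun b hb => ?_
          obtain ⟨i, -, hi⟩ := Finset.mem_biUnion.1 hb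
          exact (Finset.mem_inter.1 hi).1

theorem or {α : Type*} {P Q : α → α → Prop} {M N : ℕ} (hP : HasDecomposition P M)
    (hQ : HasDecomposition Q N) (hPQ : ∀ x y, P x y → ¬ Q x y) :
    HasDecomposition (fun x y => P x y ∨ Q x y) (M + N) := by
  refine (iUnion (P := fun i : Bool => if i then P else Q) (N := fun i => if i then M else N)
    ?_ ?_).congr ?_ ?_
  · rintro (_ | _) <;> simpa
  · rintro (_ | _) (_ | _) x y h1 h2 <;> simp at h1 h2 ⊢
    · exact hPQ x y h2 h1
    · exact hPQ x y h1 h2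
  · intro x y
    simp [or_comm]
  · simp

theorem map {α β : Type*} {P : α → α → Prop} {N : ℕ} (h : HasDecomposition P N) {f : α → β}
    (hf : Function.Injective f) :
    HasDecomposition (fun x y => ∃ a b, P a b ∧ f a = x ∧ f b = y) N := by
  obtain ⟨B, h1, h2, h3, h4⟩ := h
  have hinj : Function.Injective (List.map f) := List.map_injective_iff.2 hf
  have hmem : ∀ a b l, (f a, f b) ∈ orderedPairs (l.map f) ↔ (a, b) ∈ orderedPairs l := by
    intro a b l
    rw [orderedPairs_map]
    exact List.mem_map_of_injective (f := Prod.map f f) (a := (a, b)) (hf.prodMap hf)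
  refine ⟨B.image (List.map f), ?_, ?_, ?_, ?_⟩
  · intro b hb
    obtain ⟨c, hc, rfl⟩ := Finset.mem_image.1 hb
    exact (h1 c hc).map hf
  · intro b hb p hp
    obtain ⟨c, hc, rfl⟩ := Finset.mem_image.1 hb
    rw [orderedPairs_map] at hp
    obtain ⟨q, hq, rfl⟩ := List.mem_map.1 hp
    exact ⟨q.1, q.2, h2 c hc q hq, rfl, rfl⟩
  · rintro _ _ ⟨a, b, hab, rfl, rfl⟩
    obtain ⟨c, ⟨hc, hc'⟩, hu⟩ := h3 a b hab
    refine ⟨c.map f, ⟨Finset.mem_image_of_mem _ hc, (hmem a b c).2 hc'⟩, ?_⟩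
    rintro d ⟨hd, hd'⟩
    obtain ⟨e, he, rfl⟩ := Finset.mem_image.1 hd
    rw [hu e ⟨he, (hmem a b e).1 hd'⟩]
  · intro S _ hS
    have hN := h4 (B.filter fun b => b.map f ∈ S) (Finset.filter_subset _ _) ?_
    · refine hN.trans ?_
      rw [← Finset.card_image_of_injective _ hinj]
      refine Finset.card_le_card fun b hb => ?_
      obtain ⟨c, hc, rfl⟩ := Finset.mem_image.1 hb
      exact (Finset.mem_filter.1 hc).2
    · intro b hb c hc hbc
      simpa [hb, hc] using hS _ (Finset.mem_image_of_mem _ hb) _ (Finset.mem_image_of_mem _ hc)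
        (hbc.map f)

theorem clique {α : Type*} {c : List (List α)} (hc : ∀ b ∈ c, IsBlock 4 b)
    (hnd : (c.flatMap orderedPairs).Nodup) (hsw : c.Pairwise Swappable) :
    HasDecomposition (fun x y => (x, y) ∈ c.flatMap orderedPairs) (c.length - 1) := by
  have hpw := (List.nodup_flatMap.1 hnd).2
  have : Std.Symm (Function.onFun List.Disjoint (orderedPairs (α := α))) :=
    ⟨fun _ _ h => List.Disjoint.symm h⟩
  have : Std.Symm (Swappable (α := α)) := ⟨fun _ _ h => h.symm⟩
  have hcn : c.Nodup := by
    refine List.Pairwise.imp_of_mem (S := (· ≠ ·)) ?_ hpw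
    rintro a b ha _ hab rfl
    obtain ⟨p, hp⟩ := (hc a ha).exists_mem_orderedPairs
    exact hab hp hp
  refine ⟨c.toFinset, by simpa using hc, ?_, ?_, ?_⟩
  · intro b hb p hp
    exact List.mem_flatMap.2 ⟨b, List.mem_toFinset.1 hb, hp⟩
  · intro x y hxy
    obtain ⟨b, hb, hb'⟩ := List.mem_flatMap.1 hxy
    refine ⟨b, ⟨List.mem_toFinset.2 hb, hb'⟩, ?_⟩
    rintro d ⟨hd, hd'⟩
    by_contra hne
    exact hpw.forall (List.mem_toFinset.1 hd) hb hne hd' hb'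
  · intro S hS hcov
    have h1 : (c.toFinset \ S).card ≤ 1 := by
      refine Finset.card_le_one.2 fun a ha b hb => ?_
      rw [Finset.mem_sdiff] at ha hb
      by_contra hne
      have := hsw.forall (List.mem_toFinset.1 ha.1)
        (List.mem_toFinset.1 hb.1) hne
      rcases hcov a ha.1 b hb.1 this with h | h
      · exact ha.2 h
      · exact hb.2 h
    rw [Finset.card_sdiff_of_subset hS, List.toFinset_card_of_nodup hcn] at h1
    omega

end HasDecomposition

/-- The difference of an ordered pair of points of `G × T`, together with the types of both
points. -/
def typedDiff {G T : Type*} [Sub G] (p : (G × T) × (G × T)) : G × T × T :=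
  (p.2.1 - p.1.1, p.1.2, p.2.2)

/-- The translation of `G × T` by an element of `G`. -/
def pointTranslate {G T : Type*} [Add G] (t : G) (x : G × T) : G × T :=
  (t + x.1, x.2)

theorem pointTranslate_injective {G T : Type*} [AddCommGroup G] (t : G) :
    Function.Injective (pointTranslate (T := T) t) := by
  rintro ⟨x, a⟩ ⟨y, b⟩ h
  simpa [pointTranslate] using h

theorem HasDecomposition.translates_clique {G T : Type*} [AddCommGroup G] [Fintype G]
    {c : List (List (G × T))} (hc : ∀ b ∈ c, IsBlock 4 b)
    (hnd : ((c.flatMap orderedPairs).map typedDiff).Nodup) (hsw : c.Pairwise Swappable) :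
    HasDecomposition (fun x y : G × T => typedDiff (x, y) ∈ (c.flatMap orderedPairs).map typedDiff)
      (Fintype.card G * (c.length - 1)) := by
  have key := HasDecomposition.iUnion (fun t : G => (clique hc hnd.of_map hsw).map
    (pointTranslate_injective t)) ?_
  · refine key.congr ?_ (by simp)
    intro x y
    constructor
    · rintro ⟨t, a, b, hab, rfl, rfl⟩
      refine List.mem_map.2 ⟨(a, b), hab, ?_⟩
      simp [typedDiff, pointTranslate]
    · intro h
      obtain ⟨⟨⟨a, i⟩, ⟨b, j⟩⟩, hab, hd⟩ := List.mem_map.1 h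
      obtain ⟨x, k⟩ := x
      obtain ⟨y, l⟩ := y
      simp only [typedDiff, Prod.mk.injEq] at hd
      obtain ⟨hd, rfl, rfl⟩ := hd
      refine ⟨x - a, _, _, hab, ?_, ?_⟩
      · simp [pointTranslate]
      · simp only [pointTranslate, Prod.mk.injEq, and_true]
        rw [← sub_eq_zero] at hd ⊢
        rw [← hd]
        abel
  · rintro s t x y ⟨a, b, hab, rfl, rfl⟩ ⟨a', b', hab', ha, hb⟩
    have hd : typedDiff (a, b) = typedDiff (a', b') := by
      simp only [pointTranslate, Prod.mk.injEq] at ha hb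
      simp only [typedDiff, Prod.mk.injEq, ha.2, hb.2, and_true]
      calc b.1 - a.1 = (s + b.1) - (s + a.1) := by abel
        _ = b'.1 - a'.1 := by rw [← ha.1, ← hb.1]; abel
    have := List.inj_on_of_nodup_map hnd hab hab' hd
    obtain ⟨rfl, rfl⟩ := Prod.mk.inj this
    simp only [pointTranslate, Prod.mk.injEq, add_left_inj] at ha
    exact ha.1.symm

theorem HasDecomposition.translates {G T : Type*} [AddCommGroup G] [Fintype G]
    {C : List (List (List (G × T)))} (hC : ∀ c ∈ C, ∀ b ∈ c, IsBlock 4 b)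
    (hnd : ((C.flatten.flatMap orderedPairs).map typedDiff).Nodup)
    (hsw : ∀ c ∈ C, c.Pairwise Swappable) :
    HasDecomposition
      (fun x y : G × T => typedDiff (x, y) ∈ (C.flatten.flatMap orderedPairs).map typedDiff)
      (Fintype.card G * (C.map fun c => c.length - 1).sum) := by
  induction C with
  | nil => simpa using of_isEmpty
  | cons c C ih =>
    simp only [List.flatten_cons, List.flatMap_append, List.map_append] at hnd ⊢
    obtain ⟨h1, h2, h3⟩ := List.nodup_append.1 hnd
    refine ((translates_clique (hC c (by simp)) h1 (hsw c (by simp))).or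
      (ih (fun d hd => hC d (by simp [hd])) h2 (fun d hd => hsw d (by simp [hd]))) ?_).congr ?_ ?_
    · intro x y hx hy
      exact h3 _ hx _ hy rfl
    · intro x y
      rw [List.mem_append]
    · simp [mul_add]

instance {α : Type*} [DecidableEq α] (b c : List α) : Decidable (Swappable b c) :=
  inferInstanceAs (Decidable (∃ p ∈ adjacentPairs b, p.swap ∈ adjacentPairs c))

instance {α : Type*} [DecidableEq α] (k : ℕ) (b : List α) : Decidable (IsBlock k b) :=
  inferInstanceAs (Decidable (b.Nodup ∧ b.length = k))

/-- The natural number `k` regarded as a code for a point of `Fin n × Fin T`. -/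
def decodePoint (n T : ℕ) [NeZero n] [NeZero T] (k : ℕ) : Fin n × Fin T :=
  (Fin.ofNat n k, Fin.ofNat T (k / n))

/-- The cliques of blocks on `Fin n × Fin T` coded by lists of natural numbers. -/
def decodeCliques (n T : ℕ) [NeZero n] [NeZero T] (C : List (List (List ℕ))) :
    List (List (List (Fin n × Fin T))) :=
  C.map fun c => c.map fun b => b.map (decodePoint n T)

/-- The list of all typed differences occurring in a family of cliques. -/
def cliqueDiffs {n T : ℕ} (C : List (List (List (Fin n × Fin T)))) : List (Fin n × Fin T × Fin T) :=
  (C.flatten.flatMap orderedPairs).map typedDiff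

theorem HasDecomposition.of_difference_family {n T : ℕ} [NeZero n] [NeZero T] (g : ℕ)
    (C : List (List (List ℕ)))
    (hC : ∀ c ∈ decodeCliques n T C, (∀ b ∈ c, IsBlock 4 b) ∧ c.Pairwise Swappable)
    (hnd : (cliqueDiffs (decodeCliques n T C)).Nodup)
    (hcov : ∀ d a b, (d, a, b) ∈ cliqueDiffs (decodeCliques n T C) ↔ d.val % g ≠ 0) :
    HasDecomposition (fun x y : Fin n × Fin T => (y.1 - x.1).val % g ≠ 0)
      (n * (C.map fun c => c.length - 1).sum) := by
  refine (translates (fun c hc => (hC c hc).1) hnd (fun c hc => (hC c hc).2)).congr ?_ ?_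
  · intro x y
    exact hcov _ _ _
  · simp [decodeCliques, Function.comp_def]

/-- The images of a family of coded cliques under multiplication by `1, μ, …, μ ^ (r - 1)`
modulo `n`. -/
def dilates (n μ r : ℕ) (C : List (List (List ℕ))) : List (List (List ℕ)) :=
  (List.range r).flatMap fun k => C.map fun c => c.map fun b => b.map fun x => x * μ ^ k % n

/-- The natural number whose binary digits record which differences modulo `n` occur in a family
of coded cliques. -/
def diffMask (n : ℕ) (C : List (List (List ℕ))) : ℕ :=
  (C.flatten.flatMap orderedPairs).foldr (fun p m => 2 ^ ((n - p.1 % n + p.2 % n) % n) ||| m) 0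

theorem testBit_foldr_two_pow_lor {α : Type*} (f : α → ℕ) (l : List α) (d : ℕ) :
    (l.foldr (fun p m => 2 ^ f p ||| m) 0).testBit d = true ↔ ∃ p ∈ l, f p = d := by
  induction l with
  | nil => simp
  | cons a l ih => simp [Nat.testBit_two_pow, ih]

theorem cliqueDiffs_decodeCliques (n T : ℕ) [NeZero n] [NeZero T] (C : List (List (List ℕ))) :
    cliqueDiffs (decodeCliques n T C) = (C.flatten.flatMap orderedPairs).map fun p =>
      typedDiff (decodePoint n T p.1, decodePoint n T p.2) := by
  have h : (decodeCliques n T C).flatten = C.flatten.map (List.map (decodePoint n T)) :=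
    List.map_flatten.symm
  rw [cliqueDiffs, h, List.flatMap_map]
  simp only [orderedPairs_map]
  rw [← List.map_flatMap, List.map_map]
  rfl

theorem mem_cliqueDiffs_iff_testBit {n : ℕ} [NeZero n] (C : List (List (List ℕ))) (d : Fin n) :
    (d, 0, 0) ∈ cliqueDiffs (decodeCliques n 1 C) ↔ (diffMask n C).testBit d = true := by
  rw [diffMask, testBit_foldr_two_pow_lor (fun p : ℕ × ℕ => (n - p.1 % n + p.2 % n) % n),
    cliqueDiffs_decodeCliques, List.mem_map]
  refine exists_congr fun p => and_congr_right fun _ => ?_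
  simp [typedDiff, decodePoint, Fin.ext_iff, Fin.sub_def, Fin.ofNat, Nat.mod_one]

theorem HasDecomposition.map_bijective {α β : Type*} {P : α → α → Prop} {Q : β → β → Prop} {N : ℕ}
    (h : HasDecomposition P N) {f : α → β} (hf : Function.Bijective f)
    (hPQ : ∀ x y, P x y ↔ Q (f x) (f y)) : HasDecomposition Q N := by
  refine (h.map hf.1).congr (fun x y => ?_) le_rfl
  obtain ⟨a, rfl⟩ := hf.2 x
  obtain ⟨b, rfl⟩ := hf.2 y
  constructor
  · rintro ⟨a', b', hab, ha, hb⟩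
    rwa [← hPQ, ← hf.1 ha, ← hf.1 hb]
  · exact fun hab => ⟨a, b, (hPQ a b).2 hab, rfl, rfl⟩

theorem HasDecomposition.of_cyclic_family {n N : ℕ} [NeZero n] (C : List (List (List ℕ)))
    (hC : ∀ c ∈ decodeCliques n 1 C, (∀ b ∈ c, IsBlock 4 b) ∧ c.Pairwise Swappable)
    (hcov : diffMask n C = 2 ^ n - 2) (hlen : C.flatten.length * 6 = n - 1)
    (hN : N ≤ n * (C.map fun c => c.length - 1).sum) :
    HasDecomposition (fun x y : Fin n => x ≠ y) N := by
  have hmem : ∀ d : Fin n × Fin 1 × Fin 1,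
      d ∈ cliqueDiffs (decodeCliques n 1 C) ↔ d.1 ≠ 0 := by
    rintro ⟨d, a, b⟩
    rw [Subsingleton.elim a 0, Subsingleton.elim b 0, mem_cliqueDiffs_iff_testBit, hcov]
    rw [Nat.testBit_two_pow_sub_succ (Nat.one_lt_two_pow (NeZero.ne n))]
    rw [Bool.and_eq_true, Bool.not_eq_true', ← Bool.not_eq_true,
      Nat.testBit_one_eq_true_iff_self_eq_zero, Fin.val_eq_zero_iff]
    simp
  have hnd : (cliqueDiffs (decodeCliques n 1 C)).Nodup := by
    have hlen' : (cliqueDiffs (decodeCliques n 1 C)).length = n - 1 := by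
      rw [cliqueDiffs_decodeCliques, List.length_map, ← hlen, List.length_flatMap]
      have h6 : ∀ b ∈ C.flatten, (orderedPairs b).length = 6 := by
        intro b hb
        obtain ⟨c, hc, hb⟩ := List.mem_flatten.1 hb
        have hb' := (hC _ (List.mem_map_of_mem hc)).1 _ (List.mem_map_of_mem hb)
        rw [← (hb'.length_orderedPairs), orderedPairs_map, List.length_map]
      rw [List.map_congr_left h6, List.map_const', List.sum_replicate, smul_eq_mul]
    have hset : (cliqueDiffs (decodeCliques n 1 C)).toFinset
        = (Finset.univ.erase (0 : Fin n)).image fun d => (d, 0, 0) := by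
      ext ⟨d, a, b⟩
      simp [hmem, Subsingleton.elim a 0, Subsingleton.elim b 0]
    have hcard := congrArg Finset.card hset
    rw [Finset.card_image_of_injective _ fun _ _ h => (Prod.mk.inj h).1,
      Finset.card_erase_of_mem (Finset.mem_univ _), Finset.card_univ,
      Fintype.card_fin, ← hlen'] at hcard
    exact Multiset.coe_nodup.1 (Multiset.toFinset_card_eq_card_iff_nodup.1 hcard)
  have h := of_difference_family n C hC hnd (fun d a b => by
    rw [hmem, Nat.mod_eq_of_lt d.isLt, ne_eq, ne_eq, Fin.val_eq_zero_iff])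
  have hf : Function.Injective (Prod.fst : Fin n × Fin 1 → Fin n) := fun x y hxy =>
    Prod.ext hxy (Subsingleton.elim _ _)
  refine (h.map_bijective (Q := (· ≠ ·)) ⟨hf, fun x => ⟨(x, 0), rfl⟩⟩ fun x y => ?_).congr
    (fun _ _ => Iff.rfl) hN
  rw [Nat.mod_eq_of_lt (Fin.isLt _), ne_eq, Fin.val_eq_zero_iff, sub_eq_zero, ne_comm]

theorem hasDecomposition_six_pow_four :
    HasDecomposition (fun x y : Fin 4 × Fin 6 => x.1 ≠ y.1) 48 := by
  have h := HasDecomposition.of_difference_family (n := 12) (T := 2) 4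
    [[[9, 0, 11, 18], [11, 0, 22, 5], [22, 0, 9, 7]],
      [[17, 12, 10, 23], [10, 12, 15, 13], [15, 12, 17, 6]]]
    (by decide +kernel) (by decide +kernel) (by decide +kernel)
  have hf : Function.Bijective fun x : Fin 12 × Fin 2 =>
      (Fin.ofNat 4 x.1, Fin.ofNat 6 (x.1 / 4 + 3 * x.2)) :=
    ⟨by decide +kernel, by decide +kernel⟩
  exact h.map_bijective hf (by decide +kernel)

theorem hasDecomposition_six_pow_five :
    HasDecomposition (fun x y : Fin 5 × Fin 6 => x.1 ≠ y.1) 80 := by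
  have h := HasDecomposition.of_difference_family (n := 10) (T := 3) 5
    [[[26, 0, 9, 18], [9, 0, 23, 21], [24, 23, 0, 26]],
      [[19, 12, 0, 11], [11, 0, 8, 27], [8, 0, 12, 4]],
      [[16, 0, 17, 28], [21, 17, 0, 3], [22, 3, 0, 16]],
      [[13, 20, 11, 17], [23, 11, 20, 24], [16, 24, 20, 13]]]
    (by decide +kernel) (by decide +kernel) (by decide +kernel)
  have hf : Function.Bijective fun x : Fin 10 × Fin 3 =>
      (Fin.ofNat 5 x.1, Fin.ofNat 6 (x.1 / 5 + 2 * x.2)) :=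
    ⟨by decide +kernel, by decide +kernel⟩
  exact h.map_bijective hf (by decide +kernel)

open HasDecomposition

theorem hasDecomposition_7 : HasDecomposition (fun x y : Fin 7 => x ≠ y) 0 :=
  of_cyclic_family
    [[[5, 0, 3, 4]]]
    (by decide +kernel) (by decide +kernel) (by decide +kernel) (by decide +kernel)

theorem hasDecomposition_19 : HasDecomposition (fun x y : Fin 19 => x ≠ y) 38 :=
  of_cyclic_family
    [[[17, 0, 16, 7], [16, 0, 5, 1], [5, 0, 17, 11]]]
    (by decide +kernel) (by decide +kernel) (by decide +kernel) (by decide +kernel)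

theorem hasDecomposition_31 : HasDecomposition (fun x y : Fin 31 => x ≠ y) 93 :=
  of_cyclic_family
    [[[28, 16, 0, 5], [9, 5, 0, 7], [7, 0, 16, 6]],
      [[3, 0, 13, 14], [13, 0, 25, 17]]]
    (by decide +kernel) (by decide +kernel) (by decide +kernel) (by decide +kernel)

theorem hasDecomposition_43 : HasDecomposition (fun x y : Fin 43 => x ≠ y) 172 :=
  of_cyclic_family
    [[[39, 29, 0, 18], [1, 18, 0, 41], [17, 41, 0, 29]],
      [[30, 35, 0, 7], [22, 7, 0, 16], [16, 0, 35, 3]],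
      [[0, 38, 34, 1]]]
    (by decide +kernel) (by decide +kernel) (by decide +kernel) (by decide +kernel)

theorem hasDecomposition_55 : HasDecomposition (fun x y : Fin 55 => x ≠ y) 330 :=
  of_cyclic_family
    [[[17, 0, 41, 9], [41, 0, 4, 43], [4, 0, 17, 46]],
      [[21, 0, 20, 53], [20, 0, 5, 31], [5, 0, 21, 15]],
      [[7, 0, 19, 8], [52, 19, 0, 25], [25, 0, 7, 52]]]
    (by decide +kernel) (by decide +kernel) (by decide +kernel) (by decide +kernel)

theorem hasDecomposition_67 : HasDecomposition (fun x y : Fin 67 => x ≠ y) 469 :=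
  of_cyclic_family
    [[[15, 31, 0, 33], [33, 0, 19, 29], [56, 19, 0, 31]],
      [[35, 17, 0, 24], [24, 0, 47, 51], [47, 0, 17, 55]],
      [[1, 0, 6, 46], [32, 6, 0, 9], [54, 9, 0, 1]],
      [[0, 28, 26, 21], [28, 0, 25, 15]]]
    (by decide +kernel) (by decide +kernel) (by decide +kernel) (by decide +kernel)

theorem hasDecomposition_79 : HasDecomposition (fun x y : Fin 79 => x ≠ y) 632 :=
  of_cyclic_family
    [[[3, 1, 0, 11], [11, 0, 50, 69], [50, 0, 1, 7]],
      [[75, 13, 0, 27], [27, 0, 51, 53], [17, 51, 0, 13]],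
      [[42, 18, 0, 33], [33, 0, 25, 65], [30, 25, 0, 18]],
      [[16, 0, 59, 64], [56, 59, 0, 22], [22, 0, 16, 60]],
      [[0, 35, 47, 56]]]
    (by decide +kernel) (by decide +kernel) (by decide +kernel) (by decide +kernel)

theorem hasDecomposition_91 : HasDecomposition (fun x y : Fin 91 => x ≠ y) 910 :=
  of_cyclic_family
    [[[87, 0, 81, 78], [49, 81, 0, 66], [39, 66, 0, 87]],
      [[16, 54, 0, 47], [47, 0, 65, 13], [65, 0, 54, 3]],
      [[24, 33, 0, 86], [40, 86, 0, 63], [18, 63, 0, 33]],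
      [[69, 50, 0, 8], [8, 0, 77, 6], [77, 0, 50, 2]],
      [[32, 1, 0, 12], [12, 0, 36, 19], [57, 36, 0, 1]]]
    (by decide +kernel) (by decide +kernel) (by decide +kernel) (by decide +kernel)

theorem hasDecomposition_103 : HasDecomposition (fun x y : Fin 103 => x ≠ y) 1133 :=
  of_cyclic_family
    [[[76, 0, 15, 93], [15, 0, 48, 11], [48, 0, 76, 95]],
      [[41, 0, 57, 64], [57, 0, 35, 75], [35, 0, 41, 72]],
      [[100, 9, 0, 2], [2, 0, 102, 85], [32, 102, 0, 9]],
      [[47, 90, 0, 36], [36, 0, 58, 24], [29, 58, 0, 90]],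
      [[30, 0, 50, 84], [50, 0, 26, 89], [26, 0, 30, 51]],
      [[59, 43, 0, 38], [44, 38, 0, 52]]]
    (by decide +kernel) (by decide +kernel) (by decide +kernel) (by decide +kernel)

theorem hasDecomposition_115 : HasDecomposition (fun x y : Fin 115 => x ≠ y) 1380 :=
  of_cyclic_family
    [[[24, 0, 104, 88], [10, 104, 0, 108], [23, 108, 0, 24]],
      [[102, 63, 0, 68], [68, 0, 20, 55], [20, 0, 63, 78]],
      [[61, 0, 42, 90], [28, 42, 0, 36], [36, 0, 61, 46]],
      [[59, 0, 50, 110], [50, 0, 38, 107], [40, 38, 0, 59]],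
      [[103, 62, 0, 89], [87, 89, 0, 44], [44, 0, 62, 84]],
      [[82, 0, 112, 6], [112, 0, 83, 34], [66, 83, 0, 82]],
      [[70, 0, 111, 93]]]
    (by decide +kernel) (by decide +kernel) (by decide +kernel) (by decide +kernel)

theorem hasDecomposition_163 : HasDecomposition (fun x y : Fin 163 => x ≠ y) 2934 :=
  of_cyclic_family
    [[[41, 14, 0, 89], [89, 0, 105, 22], [105, 0, 14, 1]],
      [[156, 32, 0, 145], [145, 0, 157, 102], [157, 0, 32, 133]],
      [[107, 0, 118, 111], [118, 0, 78, 61], [116, 78, 0, 107]],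
      [[19, 0, 15, 28], [51, 15, 0, 103], [103, 0, 19, 40]],
      [[1, 34, 0, 99], [143, 99, 0, 140], [140, 0, 34, 128]],
      [[16, 53, 0, 70], [72, 70, 0, 153], [86, 153, 0, 53]],
      [[160, 66, 0, 68], [68, 0, 114, 92], [87, 114, 0, 66]],
      [[119, 42, 0, 73], [73, 0, 155, 116], [155, 0, 42, 126]],
      [[158, 0, 138, 30], [138, 0, 26, 62], [54, 26, 0, 158]]]
    (by decide +kernel) (by decide +kernel) (by decide +kernel) (by decide +kernel)

theorem hasDecomposition_223 : HasDecomposition (fun x y : Fin 223 => x ≠ y) 5352 :=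
  of_cyclic_family
    [[[28, 0, 55, 188], [55, 0, 30, 64], [112, 30, 0, 28]],
      [[27, 65, 0, 161], [141, 161, 0, 140], [140, 0, 65, 201]],
      [[114, 186, 0, 73], [80, 73, 0, 97], [129, 97, 0, 186]],
      [[191, 153, 0, 197], [220, 197, 0, 76], [204, 76, 0, 153]],
      [[157, 0, 178, 18], [118, 178, 0, 106], [106, 0, 157, 113]],
      [[71, 0, 104, 68], [104, 0, 85, 154], [85, 0, 71, 86]],
      [[180, 130, 0, 165], [165, 0, 177, 181], [148, 177, 0, 130]],
      [[187, 212, 0, 88], [98, 88, 0, 210], [210, 0, 212, 131]],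
      [[182, 39, 0, 49], [49, 0, 215, 163], [215, 0, 39, 23]],
      [[125, 5, 0, 167], [167, 0, 100, 52], [9, 100, 0, 5]],
      [[43, 170, 0, 164], [142, 164, 0, 78], [24, 78, 0, 170]],
      [[94, 74, 0, 40], [40, 0, 107, 155], [107, 0, 74, 194]],
      [[0, 192, 206, 101]]]
    (by decide +kernel) (by decide +kernel) (by decide +kernel) (by decide +kernel)

theorem hasDecomposition_235 : HasDecomposition (fun x y : Fin 235 => x ≠ y) 6110 :=
  of_cyclic_family
    [[[78, 87, 0, 85], [38, 85, 0, 29], [29, 0, 87, 141]],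
      [[191, 35, 0, 55], [218, 55, 0, 224], [224, 0, 35, 216]],
      [[39, 0, 32, 70], [32, 0, 159, 204], [159, 0, 39, 89]],
      [[201, 223, 0, 176], [176, 0, 171, 14], [61, 171, 0, 223]],
      [[21, 0, 234, 144], [234, 0, 134, 167], [134, 0, 21, 107]],
      [[127, 111, 0, 152], [152, 0, 154, 77], [225, 154, 0, 111]],
      [[14, 57, 0, 42], [141, 42, 0, 232], [232, 0, 57, 5]],
      [[170, 0, 129, 142], [129, 0, 109, 49], [155, 109, 0, 170]],
      [[216, 147, 0, 137], [62, 137, 0, 131], [205, 131, 0, 147]],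
      [[96, 0, 24, 149], [140, 24, 0, 92], [92, 0, 96, 56]],
      [[51, 0, 118, 114], [44, 118, 0, 84], [173, 84, 0, 51]],
      [[115, 97, 0, 133], [133, 0, 26, 116], [49, 26, 0, 97]],
      [[135, 82, 0, 105], [105, 0, 132, 198], [95, 132, 0, 82]]]
    (by decide +kernel) (by decide +kernel) (by decide +kernel) (by decide +kernel)

theorem hasDecomposition_247 : HasDecomposition (fun x y : Fin 247 => x ≠ y) 6669 :=
  of_cyclic_family
    [[[140, 0, 176, 111], [72, 176, 0, 216], [118, 216, 0, 140]],
      [[98, 131, 0, 89], [89, 0, 25, 19], [25, 0, 131, 75]],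
      [[133, 0, 100, 138], [100, 0, 210, 118], [210, 0, 133, 64]],
      [[130, 0, 68, 225], [68, 0, 60, 74], [17, 60, 0, 130]],
      [[161, 0, 213, 103], [213, 0, 15, 224], [15, 0, 161, 62]],
      [[126, 0, 87, 51], [87, 0, 2, 154], [2, 0, 126, 125]],
      [[59, 79, 0, 201], [201, 0, 10, 63], [10, 0, 79, 65]],
      [[16, 3, 0, 12], [67, 12, 0, 151], [151, 0, 3, 85]],
      [[164, 0, 32, 159], [171, 32, 0, 91], [11, 91, 0, 164]],
      [[19, 221, 0, 203], [115, 203, 0, 119], [119, 0, 221, 66]],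
      [[41, 186, 0, 135], [135, 0, 240, 136], [240, 0, 186, 134]],
      [[193, 223, 0, 150], [127, 150, 0, 166], [206, 166, 0, 223]],
      [[27, 0, 35, 200], [205, 35, 0, 48], [202, 48, 0, 27]],
      [[226, 0, 169, 198], [219, 189, 169, 0]]]
    (by decide +kernel) (by decide +kernel) (by decide +kernel) (by decide +kernel)

theorem hasDecomposition_259 : HasDecomposition (fun x y : Fin 259 => x ≠ y) 6993 :=
  of_cyclic_family
    ([[[185, 0, 111, 148]]] ++ dilates 259 232 3
    [[[80, 0, 102, 89], [242, 102, 0, 199], [199, 0, 80, 150]],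
      [[62, 225, 0, 155], [155, 0, 158, 72], [169, 158, 0, 225]],
      [[82, 212, 0, 247], [30, 247, 0, 69], [40, 69, 0, 212]],
      [[93, 1, 0, 136], [136, 0, 23, 249], [23, 0, 1, 63]],
      [[35, 210, 0, 159], [195, 163, 159, 0]]])
    (by decide +kernel) (by decide +kernel) (by decide +kernel) (by decide +kernel)

theorem hasDecomposition_403 : HasDecomposition (fun x y : Fin 403 => x ≠ y) 17329 :=
  of_cyclic_family
    ([[[31, 0, 279, 93], [93, 279, 0, 31]],
      [[122, 0, 402, 65], [57, 65, 402, 325]],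
      [[213, 0, 246, 130], [83, 130, 246, 247]],
      [[278, 0, 77, 234]]] ++ dilates 403 157 5
    [[[87, 0, 380, 199], [380, 0, 14, 369], [321, 14, 0, 87]],
      [[53, 127, 0, 324], [71, 324, 0, 182], [182, 0, 127, 133]],
      [[50, 0, 283, 99], [283, 0, 351, 305], [351, 0, 50, 5]],
      [[343, 0, 147, 149], [280, 147, 0, 139], [128, 139, 0, 343]]])
    (by decide +kernel) (by decide +kernel) (by decide +kernel) (by decide +kernel)

theorem HasDecomposition.ne_of_card_eq {α β : Type*} [Finite α] [Finite β] {N : ℕ}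
    (h : HasDecomposition (fun x y : α => x ≠ y) N) (hc : Nat.card α = Nat.card β) :
    HasDecomposition (fun x y : β => x ≠ y) N := by
  obtain ⟨e⟩ := Finite.card_eq.1 hc
  exact h.map_bijective e.bijective fun _ _ => e.injective.ne_iff.symm

theorem HasDecomposition.fst_ne_of_card_eq {α β γ : Type*} [Finite α] [Finite β] {N : ℕ}
    (h : HasDecomposition (fun x y : α × γ => x.1 ≠ y.1) N) (hc : Nat.card α = Nat.card β) :
    HasDecomposition (fun x y : β × γ => x.1 ≠ y.1) N := by
  obtain ⟨e⟩ := Finite.card_eq.1 hc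
  exact h.map_bijective (e.prodCongr (Equiv.refl γ)).bijective fun _ _ => e.injective.ne_iff.symm

/-- Wilson's fundamental construction: the points of a group divisible design with groups the
fibres of `g` and blocks `L i` are given weight six, and a new point is added to every group. -/
theorem HasDecomposition.inflate {X γ ι : Type*} [Fintype γ] [Fintype ι] (g : X → γ)
    (L : ι → Finset X) (hg : ∀ i, ∀ x ∈ L i, ∀ y ∈ L i, g x = g y → x = y)
    (hL : ∀ x y, g x ≠ g y → ∃! i, x ∈ L i ∧ y ∈ L i) {N : γ → ℕ} {M : ι → ℕ}
    (hN : ∀ c, HasDecomposition (fun x y : Option ({x // g x = c} × Fin 6) => x ≠ y) (N c))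
    (hM : ∀ i, HasDecomposition (fun x y : L i × Fin 6 => x.1 ≠ y.1) (M i)) :
    HasDecomposition (fun x y : Option (X × Fin 6) => x ≠ y) (∑ c, N c + ∑ i, M i) := by
  have hA : ∀ c, HasDecomposition (fun u w : Option (X × Fin 6) =>
      u ≠ w ∧ (∀ p ∈ u, g p.1 = c) ∧ ∀ p ∈ w, g p.1 = c) (N c) := by
    intro c
    have hf : Function.Injective
        (Option.map (Prod.map Subtype.val id) : Option ({x // g x = c} × Fin 6) → _) :=
      Option.map_injective (Subtype.val_injective.prodMap Function.injective_id)
    refine ((hN c).map hf).congr (fun u w => ?_) le_rfl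
    have hsurj : ∀ u : Option (X × Fin 6), (∀ p ∈ u, g p.1 = c) ↔
        ∃ a : Option ({x // g x = c} × Fin 6), a.map (Prod.map Subtype.val id) = u := by
      rintro (_ | ⟨x, k⟩)
      · simp
      · constructor
        · exact fun h => ⟨some (⟨x, h _ rfl⟩, k), rfl⟩
        · rintro ⟨_ | ⟨⟨y, hy⟩, j⟩, h⟩
          · simp at h
          · simp only [Option.map_some, Prod.map_apply, id_eq, Option.some.injEq,
              Prod.mk.injEq] at h
            obtain ⟨rfl, rfl⟩ := h
            simpa using hy
    rw [hsurj, hsurj]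
    constructor
    · rintro ⟨a, b, hab, rfl, rfl⟩
      exact ⟨hf.ne hab, ⟨a, rfl⟩, ⟨b, rfl⟩⟩
    · rintro ⟨hne, ⟨a, rfl⟩, ⟨b, rfl⟩⟩
      exact ⟨a, b, fun h => hne (h ▸ rfl), rfl, rfl⟩
  have hB : ∀ i, HasDecomposition (fun u w : Option (X × Fin 6) =>
      ∃ p q, u = some p ∧ w = some q ∧ p.1 ∈ L i ∧ q.1 ∈ L i ∧ p.1 ≠ q.1) (M i) := by
    intro i
    have hf : Function.Injective
        (fun p : L i × Fin 6 => (some (p.1.1, p.2) : Option (X × Fin 6))) := by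
      rintro ⟨⟨x, hx⟩, k⟩ ⟨⟨y, hy⟩, j⟩ h
      simpa using h
    refine ((hM i).map hf).congr (fun u w => ?_) le_rfl
    constructor
    · rintro ⟨a, b, hab, rfl, rfl⟩
      exact ⟨_, _, rfl, rfl, a.1.2, b.1.2, fun h => hab (Subtype.ext h)⟩
    · rintro ⟨p, q, rfl, rfl, hp, hq, hpq⟩
      exact ⟨(⟨p.1, hp⟩, p.2), (⟨q.1, hq⟩, q.2), fun h => hpq (congrArg Subtype.val h), rfl, rfl⟩
  refine ((iUnion hA ?_).or (iUnion hB ?_) ?_).congr ?_ le_rfl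
  · rintro c d (_ | p) (_ | q) ⟨hne, h1, h2⟩ ⟨-, h3, h4⟩
    · exact absurd rfl hne
    · rw [← h2 q rfl, ← h4 q rfl]
    · rw [← h1 p rfl, ← h3 p rfl]
    · rw [← h1 p rfl, ← h3 p rfl]
  · rintro i j _ _ ⟨p, q, rfl, rfl, hp, hq, hpq⟩ ⟨p', q', h1, h2, hp', hq', -⟩
    obtain rfl := Option.some.inj h1
    obtain rfl := Option.some.inj h2
    exact (hL p.1 q.1 fun h => hpq (hg i _ hp _ hq h)).unique ⟨hp, hq⟩ ⟨hp', hq'⟩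
  · rintro _ _ ⟨c, -, h1, h2⟩ ⟨i, p, q, rfl, rfl, hp, hq, hpq⟩
    exact hpq (hg i _ hp _ hq ((h1 p rfl).trans (h2 q rfl).symm))
  · intro u w
    constructor
    · rintro (⟨c, h, -⟩ | ⟨i, p, q, rfl, rfl, -, -, h⟩)
      · exact h
      · exact fun heq => h (congrArg Prod.fst (Option.some.inj heq))
    · intro h
      rcases u with _ | p <;> rcases w with _ | q
      · exact absurd rfl h
      · exact Or.inl ⟨g q.1, h, by simp, by simp⟩
      · exact Or.inl ⟨g p.1, h, by simp, by simp⟩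
      · by_cases hpq : g p.1 = g q.1
        · exact Or.inl ⟨g p.1, h, by simp, by simp [hpq]⟩
        · obtain ⟨i, ⟨h1, h2⟩, -⟩ := hL _ _ hpq
          exact Or.inr ⟨i, p, q, rfl, rfl, h1, h2, fun h => hpq (congrArg g h)⟩

/-- The points of the line with intercept `x` and slope `y` in a transversal design with four
groups of size `m` and a fifth group truncated to size `s`. -/
def truncatedLine (m s : ℕ) [NeZero m] (x y : ZMod m) :
    Finset (Fin 4 × ZMod m ⊕ {z : ZMod m // z.val < s}) :=
  (Finset.univ.image fun c : Fin 4 => (c, x + (c.val : ZMod m) * y)).disjSum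
    (Finset.univ.filter fun z => z.1 = y)

theorem inl_mem_truncatedLine {m s : ℕ} [NeZero m] {x y z : ZMod m} {c : Fin 4} :
    Sum.inl (c, z) ∈ truncatedLine m s x y ↔ x + (c.val : ZMod m) * y = z := by
  simp [truncatedLine]

theorem inr_mem_truncatedLine {m s : ℕ} [NeZero m] {x y : ZMod m}
    {z : {z : ZMod m // z.val < s}} : Sum.inr z ∈ truncatedLine m s x y ↔ z.1 = y := by
  simp [truncatedLine]

theorem card_truncatedLine (m s : ℕ) [NeZero m] (x y : ZMod m) :
    (truncatedLine m s x y).card = if y.val < s then 5 else 4 := by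
  have h1 : (Finset.univ.image fun c : Fin 4 => (c, x + (c.val : ZMod m) * y)).card = 4 :=
    Finset.card_image_of_injective _ fun _ _ h => (Prod.mk.inj h).1
  rw [truncatedLine, Finset.card_disjSum, h1]
  split_ifs with h
  · have : (Finset.univ.filter fun z : {z : ZMod m // z.val < s} => z.1 = y) = {⟨y, h⟩} := by
      ext z
      simp [Subtype.ext_iff]
    rw [this, Finset.card_singleton]
  · have : (Finset.univ.filter fun z : {z : ZMod m // z.val < s} => z.1 = y) = ∅ := by
      ext z
      have : z.1 ≠ y := fun hz => h (hz ▸ z.2)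
      simp [this]
    rw [this, Finset.card_empty]

theorem isUnit_natCast_sub_natCast {m : ℕ} (hm : m.Coprime 6) {c d : Fin 4} (h : c ≠ d) :
    IsUnit ((c.val : ZMod m) - (d.val : ZMod m)) := by
  have h2 : IsUnit (2 : ZMod m) := by
    exact_mod_cast (ZMod.isUnit_iff_coprime 2 m).2 (hm.coprime_dvd_right (by norm_num)).symm
  have h3 : IsUnit (3 : ZMod m) := by
    exact_mod_cast (ZMod.isUnit_iff_coprime 3 m).2 (hm.coprime_dvd_right (by norm_num)).symm
  fin_cases c <;> fin_cases d <;> first | exact absurd rfl h | norm_num [h2, h3]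

theorem existsUnique_truncatedLine {m s : ℕ} [NeZero m] (hm : m.Coprime 6)
    (p q : Fin 4 × ZMod m ⊕ {z : ZMod m // z.val < s})
    (hpq : Sum.map Prod.fst (fun _ => ()) p ≠ Sum.map Prod.fst (fun _ => ()) q) :
    ∃! l : ZMod m × ZMod m, p ∈ truncatedLine m s l.1 l.2 ∧ q ∈ truncatedLine m s l.1 l.2 := by
  rcases p with ⟨c, z⟩ | z <;> rcases q with ⟨d, w⟩ | w
  · have hcd : c ≠ d := fun h => hpq (congrArg Sum.inl h)
    obtain ⟨u, hu⟩ := isUnit_natCast_sub_natCast hm hcd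
    have hu' : u * (↑u⁻¹ * (z - w)) = z - w := by simp
    rw [hu] at hu'
    refine ⟨(z - c.val * (↑u⁻¹ * (z - w)), ↑u⁻¹ * (z - w)), ?_, ?_⟩
    · simp only [inl_mem_truncatedLine]
      exact ⟨by ring, by linear_combination -hu'⟩
    · rintro ⟨x, y⟩ ⟨h1, h2⟩
      rw [inl_mem_truncatedLine] at h1 h2
      have hy : y = ↑u⁻¹ * (z - w) := by
        rw [Units.eq_inv_mul_iff_mul_eq, hu, ← h1, ← h2]
        ring
      rw [← hy, ← h1]
      simp
  · refine ⟨(z - c.val * w, w), ?_, ?_⟩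
    · simp [inl_mem_truncatedLine, inr_mem_truncatedLine]
    · rintro ⟨x, y⟩ ⟨h1, h2⟩
      rw [inl_mem_truncatedLine] at h1
      rw [inr_mem_truncatedLine] at h2
      simp [← h1, h2]
  · refine ⟨(w - d.val * z, z), ?_, ?_⟩
    · simp [inl_mem_truncatedLine, inr_mem_truncatedLine]
    · rintro ⟨x, y⟩ ⟨h1, h2⟩
      rw [inl_mem_truncatedLine] at h2
      rw [inr_mem_truncatedLine] at h1
      simp [← h2, h1]
  · exact absurd rfl hpq

theorem card_zmod_val_lt {m s : ℕ} [NeZero m] (hs : s ≤ m) :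
    (Finset.univ.filter fun z : ZMod m => z.val < s).card = s := by
  obtain ⟨k, rfl⟩ := Nat.exists_eq_succ_of_ne_zero (NeZero.ne m)
  exact Fin.card_filter_val_lt.trans (min_eq_right hs)

theorem HasDecomposition.truncated_transversal {m s N₁ N₂ : ℕ} [NeZero m] (hm : m.Coprime 6)
    (hs : s ≤ m) (h₁ : HasDecomposition (fun x y : Fin (6 * m + 1) => x ≠ y) N₁)
    (h₂ : HasDecomposition (fun x y : Fin (6 * s + 1) => x ≠ y) N₂) :
    HasDecomposition (fun x y : Fin (6 * (4 * m + s) + 1) => x ≠ y)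
      (4 * N₁ + N₂ + m * (48 * m + 32 * s)) := by
  have hcs : Nat.card {z : ZMod m // z.val < s} = s := by
    rw [Nat.card_eq_fintype_card, Fintype.card_subtype, card_zmod_val_lt hs]
  have key := inflate (Sum.map Prod.fst fun _ => ())
    (fun l : ZMod m × ZMod m => truncatedLine m s l.1 l.2)
    (N := Sum.elim (fun _ : Fin 4 => N₁) fun _ : Unit => N₂)
    (M := fun l => if l.2.val < s then 80 else 48) ?_ (existsUnique_truncatedLine hm) ?_ ?_
  · refine (key.ne_of_card_eq ?_).congr (fun _ _ => Iff.rfl) ?_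
    · rw [Finite.card_option, Nat.card_prod, Nat.card_sum, hcs]
      simp only [Nat.card_prod, Nat.card_fin, Nat.card_zmod]
      ring
    · have hM : ∑ y : ZMod m, (if y.val < s then 80 else 48) = 48 * m + 32 * s := by
        have : ∀ y : ZMod m, (if y.val < s then 80 else 48) = 48 + if y.val < s then 32 else 0 := by
          intro y
          split_ifs <;> rfl
        simp only [this, Finset.sum_add_distrib, ← Finset.sum_filter, Finset.sum_const,
          card_zmod_val_lt hs, Finset.card_univ, ZMod.card, smul_eq_mul]
        ring
      rw [Fintype.sum_prod_type]
      simp [hM]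
  · rintro ⟨x, y⟩ (⟨c, z⟩ | z) hp (⟨d, w⟩ | w) hq h
    · obtain rfl : c = d := Sum.inl.inj h
      rw [inl_mem_truncatedLine] at hp hq
      rw [← hp, ← hq]
    · cases h
    · cases h
    · rw [inr_mem_truncatedLine] at hp hq
      rw [Subtype.ext (hp.trans hq.symm)]
  · rintro (c | c)
    · refine h₁.ne_of_card_eq ?_
      have e : Nat.card {x : Fin 4 × ZMod m ⊕ {z : ZMod m // z.val < s} //
          Sum.map Prod.fst (fun _ => ()) x = Sum.inl c} = m := by
        refine Eq.trans (Nat.card_eq_of_bijective (fun z => ⟨Sum.inl (c, z), rfl⟩) ⟨?_, ?_⟩).symm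
          (Nat.card_zmod m)
        · exact fun z w h => (Prod.mk.inj (Sum.inl.inj (Subtype.ext_iff.1 h))).2
        · rintro ⟨⟨d, z⟩ | z, h⟩
          · obtain rfl : d = c := Sum.inl.inj h
            exact ⟨z, rfl⟩
          · cases h
      rw [Finite.card_option, Nat.card_prod, e, Nat.card_fin, Nat.card_fin, mul_comm]
    · refine h₂.ne_of_card_eq ?_
      have e : Nat.card {x : Fin 4 × ZMod m ⊕ {z : ZMod m // z.val < s} //
          Sum.map Prod.fst (fun _ => ()) x = Sum.inr c} = s := by
        refine Eq.trans (Nat.card_eq_of_bijective (fun z => ⟨Sum.inr z, rfl⟩) ⟨?_, ?_⟩).symm hcs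
        · exact fun z w h => Sum.inr.inj (Subtype.ext_iff.1 h)
        · rintro ⟨⟨d, z⟩ | z, h⟩
          · cases h
          · exact ⟨z, rfl⟩
      rw [Finite.card_option, Nat.card_prod, e, Nat.card_fin, Nat.card_fin, mul_comm]
  · rintro ⟨x, y⟩
    have hc := card_truncatedLine m s x y
    dsimp only
    split_ifs at hc ⊢ with h
    · exact hasDecomposition_six_pow_five.fst_ne_of_card_eq (by simp [hc])
    · exact hasDecomposition_six_pow_four.fst_ne_of_card_eq (by simp [hc])

theorem exists_coprime_six {q : ℕ} (hq : 21 ≤ q) (hq' : q % 2 = 1)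
    (hne : q ∉ [27, 37, 39, 41, 43, 67]) : ∃ m, 5 ≤ m ∧ 4 * m ≤ q ∧ q ≤ 5 * m ∧ m.Coprime 6 := by
  have hcop : ∀ m : ℕ, m % 6 = 1 ∨ m % 6 = 5 → m.Coprime 6 := by
    intro m hm
    rw [Nat.coprime_comm, Nat.Coprime, Nat.gcd_rec]
    rcases hm with hm | hm <;> rw [hm] <;> rfl
  rcases lt_or_ge q 75 with h | h
  · simp only [List.mem_cons, List.not_mem_nil, or_false, not_or] at hne
    rcases (by omega : q ≤ 25 ∨ 28 ≤ q ∧ q ≤ 35 ∨ 44 ≤ q ∧ q ≤ 55 ∨ 52 ≤ q ∧ q ≤ 65 ∨ 68 ≤ q)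
      with h | h | h | h | h
    · exact ⟨5, by omega, by omega, by omega, hcop 5 (by norm_num)⟩
    · exact ⟨7, by omega, by omega, by omega, hcop 7 (by norm_num)⟩
    · exact ⟨11, by omega, by omega, by omega, hcop 11 (by norm_num)⟩
    · exact ⟨13, by omega, by omega, by omega, hcop 13 (by norm_num)⟩
    · exact ⟨17, by omega, by omega, by omega, hcop 17 (by norm_num)⟩
  · have : ∃ m, (m % 6 = 1 ∨ m % 6 = 5) ∧ m ≤ q / 4 ∧ q / 4 ≤ m + 3 := by
      have : q / 4 % 6 < 6 := Nat.mod_lt _ (by norm_num)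
      rcases (by omega : q / 4 % 6 = 1 ∨ q / 4 % 6 = 5 ∨ q / 4 % 6 = 0 ∨ q / 4 % 6 = 2 ∨
        q / 4 % 6 = 3 ∨ q / 4 % 6 = 4) with h | h | h | h | h | h
      · exact ⟨q / 4, by omega⟩
      · exact ⟨q / 4, by omega⟩
      · exact ⟨q / 4 - 1, by omega⟩
      · exact ⟨q / 4 - 1, by omega⟩
      · exact ⟨q / 4 - 2, by omega⟩
      · exact ⟨q / 4 - 3, by omega⟩
    obtain ⟨m, hm, h1, h2⟩ := this
    exact ⟨m, by omega, by omega, by omega, hcop m hm⟩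

theorem exists_hasDecomposition {q : ℕ} (hq : q % 2 = 1) :
    ∃ N, HasDecomposition (fun x y : Fin (6 * q + 1) => x ≠ y) N ∧
      15 * q ^ 2 ≤ 4 * N + 4 * q + 19 ∧ (11 ≤ q → 15 * q ^ 2 ≤ 4 * N + 4 * q + 7) := by
  induction q using Nat.strong_induction_on with
  | _ q ih =>
    by_cases hb : q < 21 ∨ q ∈ [27, 37, 39, 41, 43, 67]
    · have hb' : q ∈ [1, 3, 5, 7, 9, 11, 13, 15, 17, 19, 27, 37, 39, 41, 43, 67] := by
        rcases hb with hb | hb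
        · interval_cases q <;> simp at hq ⊢
        · simp only [List.mem_cons] at hb ⊢
          tauto
      simp only [List.mem_cons, List.not_mem_nil, or_false] at hb'
      rcases hb' with rfl | rfl | rfl | rfl | rfl | rfl | rfl | rfl | rfl | rfl | rfl | rfl | rfl |
        rfl | rfl | rfl
      · exact ⟨_, hasDecomposition_7, by norm_num, by norm_num⟩
      · exact ⟨_, hasDecomposition_19, by norm_num, by norm_num⟩
      · exact ⟨_, hasDecomposition_31, by norm_num, by norm_num⟩
      · exact ⟨_, hasDecomposition_43, by norm_num, by norm_num⟩
      · exact ⟨_, hasDecomposition_55, by norm_num, by norm_num⟩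
      · exact ⟨_, hasDecomposition_67, by norm_num, by norm_num⟩
      · exact ⟨_, hasDecomposition_79, by norm_num, by norm_num⟩
      · exact ⟨_, hasDecomposition_91, by norm_num, by norm_num⟩
      · exact ⟨_, hasDecomposition_103, by norm_num, by norm_num⟩
      · exact ⟨_, hasDecomposition_115, by norm_num, by norm_num⟩
      · exact ⟨_, hasDecomposition_163, by norm_num, by norm_num⟩
      · exact ⟨_, hasDecomposition_223, by norm_num, by norm_num⟩
      · exact ⟨_, hasDecomposition_235, by norm_num, by norm_num⟩
      · exact ⟨_, hasDecomposition_247, by norm_num, by norm_num⟩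
      · exact ⟨_, hasDecomposition_259, by norm_num, by norm_num⟩
      · exact ⟨_, hasDecomposition_403, by norm_num, by norm_num⟩
    · rw [not_or, not_lt] at hb
      obtain ⟨m, hm5, hmq, hqm, hm⟩ := exists_coprime_six hb.1 hq hb.2
      obtain ⟨s, rfl⟩ := Nat.exists_eq_add_of_le hmq
      have hm2 : m % 2 = 1 := Nat.odd_iff.1 (hm.coprime_dvd_right (by norm_num : 2 ∣ 6)).odd_of_right
      obtain ⟨N₁, h₁, hb₁, -⟩ := ih m (by omega) hm2
      obtain ⟨N₂, h₂, hb₂, -⟩ := ih s (by omega) (by omega)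
      have : NeZero m := ⟨by omega⟩
      have hbound : 15 * (4 * m + s) ^ 2 ≤
          4 * (4 * N₁ + N₂ + m * (48 * m + 32 * s)) + 4 * (4 * m + s) + 7 := by
        nlinarith [Nat.mul_le_mul hm5 hm5, Nat.zero_le (m * s)]
      exact ⟨_, .truncated_transversal hm (by omega) h₁ h₂, by omega, fun _ => hbound⟩

theorem mem_orderedPairs_append {α : Type*} {a c : α} {u v : List α} :
    (a, c) ∈ orderedPairs (u ++ v) ↔
      (a, c) ∈ orderedPairs u ∨ (a ∈ u ∧ c ∈ v) ∨ (a, c) ∈ orderedPairs v := by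
  induction u with
  | nil => simp [orderedPairs]
  | cons z u ih =>
    simp only [List.cons_append, orderedPairs, List.mem_append, List.mem_map, Prod.mk.injEq, ih,
      List.mem_cons]
    grind

theorem left_mem_of_mem_orderedPairs {α : Type*} {a c : α} {l : List α}
    (h : (a, c) ∈ orderedPairs l) : a ∈ l :=
  (mem_orderedPairs.1 h).subset (by simp)

theorem mem_orderedPairs_swap {α : Type*} {x y a c : α} {u w : List α}
    (h : (u ++ x :: y :: w).Nodup) :
    (a, c) ∈ orderedPairs (u ++ y :: x :: w) ↔
      ((a, c) ∈ orderedPairs (u ++ x :: y :: w) ∧ (a, c) ≠ (x, y)) ∨ (a, c) = (y, x) := by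
  have h1 := left_mem_of_mem_orderedPairs (a := a) (c := c) (l := u)
  have h2 := left_mem_of_mem_orderedPairs (a := a) (c := c) (l := w)
  simp only [mem_orderedPairs_append, orderedPairs, List.mem_append, List.mem_map,
    Prod.mk.injEq, List.mem_cons, ne_eq]
  have h3 : x ≠ y ∧ x ∉ u ∧ y ∉ u ∧ x ∉ w ∧ y ∉ w := by
    simp only [List.nodup_append, List.nodup_cons, List.mem_cons] at h
    grind
  grind

theorem nodup_swap {α : Type*} {x y : α} {u w : List α} (h : (u ++ x :: y :: w).Nodup) :
    (u ++ y :: x :: w).Nodup :=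
  (List.Perm.append_left u (List.Perm.swap x y w).symm).nodup h

theorem not_mem_orderedPairs_of_adjacent {α : Type*} {x y : α} {u w : List α}
    (h : (u ++ x :: y :: w).Nodup) : (y, x) ∉ orderedPairs (u ++ x :: y :: w) := by
  rw [mem_orderedPairs_swap (nodup_swap h)]
  have : x ≠ y := by
    rintro rfl
    simp [List.nodup_append] at h
  simp [this]

theorem isDD_two_iff {α : Type*} {k : ℕ} {B : Multiset (List α)} :
    IsDD 2 k 1 B ↔ (∀ b ∈ B, IsBlock k b) ∧
      ∀ x y, x ≠ y → B.countP (fun b => (x, y) ∈ orderedPairs b) = 1 := by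
  refine and_congr_right fun _ => ⟨fun h x y hxy => ?_, fun h s hs hlen => ?_⟩
  · simpa only [mem_orderedPairs] using h [x, y] (by simpa using hxy) rfl
  · obtain ⟨x, y, rfl⟩ := List.length_eq_two.1 hlen
    simpa only [mem_orderedPairs] using h x y (by simpa using hs)

theorem eq_of_countP_eq_one {α : Type*} {p : α → Prop} [DecidablePred p] {B : Multiset α} {b c : α}
    (h : B.countP p = 1) (hb : b ∈ B) (hc : c ∈ B) (hpb : p b) (hpc : p c) : b = c := by
  obtain ⟨R, rfl⟩ := Multiset.exists_cons_of_mem hb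
  rw [Multiset.countP_cons_of_pos _ hpb, Nat.add_eq_right, Multiset.countP_eq_zero] at h
  exact ((Multiset.mem_cons.1 hc).resolve_right fun hc => h c hc hpc).symm

/-- Two swappable blocks of a directed design form a directed trade, so every defining set contains
one of them. -/
theorem mem_or_mem_of_swappable {α : Type*} {B S : Multiset (List α)} {b c : List α}
    (hB : IsDD 2 4 1 B) (hS : IsDefiningSet 2 4 1 B S) (hb : b ∈ B) (hc : c ∈ B)
    (hbc : Swappable b c) : b ∈ S ∨ c ∈ S := by
  by_contra! hbS
  obtain ⟨⟨x, y⟩, h1, h2⟩ := hbc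
  obtain ⟨u, w, rfl⟩ := exists_eq_append_of_mem_adjacentPairs h1
  obtain ⟨u', w', rfl⟩ := exists_eq_append_of_mem_adjacentPairs h2
  rw [isDD_two_iff] at hB
  obtain ⟨hblock, hcount⟩ := hB
  have hnb := (hblock _ hb).1
  have hnc := (hblock _ hc).1
  have hxy : x ≠ y := by
    rintro rfl
    simp [List.nodup_append] at hnb
  have hmem : (x, y) ∈ orderedPairs (u ++ x :: y :: w) := by
    simp [mem_orderedPairs_append, orderedPairs]
  have hmem' : (y, x) ∈ orderedPairs (u' ++ y :: x :: w') := by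
    simp [mem_orderedPairs_append, orderedPairs]
  have hne : u' ++ y :: x :: w' ≠ u ++ x :: y :: w := fun h =>
    not_mem_orderedPairs_of_adjacent hnc (h ▸ hmem)
  obtain ⟨R, rfl⟩ := Multiset.exists_cons_of_mem hb
  obtain ⟨R, rfl⟩ := Multiset.exists_cons_of_mem
    ((Multiset.mem_cons.1 hc).resolve_left hne)
  have hDD : IsDD 2 4 1 ((u ++ y :: x :: w) ::ₘ (u' ++ x :: y :: w') ::ₘ R) := by
    rw [isDD_two_iff]
    refine ⟨fun d hd => ?_, fun a c hac => ?_⟩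
    · rcases Multiset.mem_cons.1 hd with rfl | hd
      · exact ⟨nodup_swap hnb, by simpa using (hblock _ hb).2⟩
      rcases Multiset.mem_cons.1 hd with rfl | hd
      · exact ⟨nodup_swap hnc, by simpa using (hblock _ hc).2⟩
      · exact hblock d (by simp [hd])
    · rw [← hcount a c hac]
      have := not_mem_orderedPairs_of_adjacent hnb
      have := not_mem_orderedPairs_of_adjacent hnc
      simp only [Multiset.countP_cons, mem_orderedPairs_swap hnb, mem_orderedPairs_swap hnc]
      by_cases h3 : (a, c) = (x, y)
      · simp_all
      by_cases h4 : (a, c) = (y, x)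
      · simp_all
      · simp only [h3, h4, ne_eq, not_false_eq_true, and_true, or_false]
  have hle : S ≤ R := (Multiset.le_cons_of_notMem hbS.2).1
    ((Multiset.le_cons_of_notMem hbS.1).1 hS.1)
  have heq := hS.2 _ hDD (hle.trans ((Multiset.le_cons_self _ _).trans (Multiset.le_cons_self _ _)))
  have hb' : u ++ y :: x :: w ∈ (u ++ x :: y :: w) ::ₘ (u' ++ y :: x :: w') ::ₘ R := by
    rw [← heq]
    exact Multiset.mem_cons_self _ _
  obtain ⟨p, q, hpq, hp, hp'⟩ : ∃ p q, p ≠ q ∧ (p, q) ∈ orderedPairs (u ++ x :: y :: w) ∧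
      (p, q) ∈ orderedPairs (u ++ y :: x :: w) := by
    have hlen := (hblock _ hb).2
    simp only [List.nodup_append, List.nodup_cons, List.mem_cons] at hnb
    rcases u with _ | ⟨z, u⟩
    · rcases w with _ | ⟨z, w⟩
      · simp at hlen
      · exact ⟨x, z, by grind, by simp [orderedPairs], by simp [orderedPairs]⟩
    · exact ⟨z, x, by grind, by simp [orderedPairs], by simp [orderedPairs]⟩
  have := eq_of_countP_eq_one (hcount p q hpq) hb hb' hp hp'
  exact hxy (by simpa using this : x = y ∧ y = x).1

theorem card_mul_six_of_decomposition {α : Type*} [Fintype α] {B : Finset (List α)}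
    (h1 : ∀ b ∈ B, IsBlock 4 b) (h2 : ∀ b ∈ B, ∀ p ∈ orderedPairs b, p.1 ≠ p.2)
    (h3 : ∀ x y : α, x ≠ y → ∃! b, b ∈ B ∧ (x, y) ∈ orderedPairs b) :
    B.card * 6 = Fintype.card α * Fintype.card α - Fintype.card α := by
  have h := Finset.card_mul_eq_card_mul (s := B) (t := (Finset.univ : Finset α).offDiag)
    (fun b p => p ∈ orderedPairs b) (m := 6) (n := 1) ?_ ?_
  · rw [h, Finset.offDiag_card, Finset.card_univ, mul_one]
  · intro b hb
    obtain ⟨hnd, hlen⟩ := h1 b hb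
    have heq : Finset.bipartiteAbove (fun b p => p ∈ orderedPairs b)
        (Finset.univ : Finset α).offDiag b = (orderedPairs b).toFinset := by
      ext p
      simpa [Finset.mem_bipartiteAbove] using h2 b hb p
    have hnd' : (orderedPairs b).Nodup := by
      obtain ⟨a, c, d, e, rfl⟩ := List.length_eq_four.1 hlen
      simp only [List.nodup_cons, List.mem_cons, List.not_mem_nil, or_false, not_or] at hnd
      simp [orderedPairs]
      grind
    rw [heq, List.toFinset_card_of_nodup hnd', (h1 b hb).length_orderedPairs]
  · rintro ⟨x, y⟩ hxy
    obtain ⟨b, hb, hu⟩ := h3 x y (by simpa using hxy)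
    rw [Finset.card_eq_one]
    refine ⟨b, Finset.ext fun c => ?_⟩
    rw [Finset.mem_bipartiteBelow, Finset.mem_singleton]
    exact ⟨hu c, fun h => h ▸ hb⟩

theorem exists_isDD_of_hasDecomposition {α : Type*} [Fintype α] {N : ℕ}
    (h : HasDecomposition (fun x y : α => x ≠ y) N) :
    ∃ B : Multiset (List α), IsDD 2 4 1 B ∧
      Multiset.card B * 6 = Fintype.card α * Fintype.card α - Fintype.card α ∧
      ∀ S, IsDefiningSet 2 4 1 B S → N ≤ Multiset.card S := by
  obtain ⟨B, h1, h2, h3, h4⟩ := h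
  have hDD : IsDD 2 4 1 B.val := by
    refine isDD_two_iff.2 ⟨h1, fun x y hxy => ?_⟩
    obtain ⟨b, hb, hu⟩ := h3 x y hxy
    have : B.filter (fun b => (x, y) ∈ orderedPairs b) = {b} := by
      ext c
      rw [Finset.mem_filter, Finset.mem_singleton]
      exact ⟨hu c, fun h => h ▸ hb⟩
    rw [Multiset.countP_eq_card_filter, ← Finset.filter_val, this]
    rfl
  refine ⟨B.val, hDD, card_mul_six_of_decomposition h1 h2 h3, fun S hS => ?_⟩
  refine (h4 S.toFinset (fun b hb => Multiset.mem_of_le hS.1 (Multiset.mem_toFinset.1 hb))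
    fun b hb c hc hbc => ?_).trans S.toFinset_card_le
  rw [Multiset.mem_toFinset, Multiset.mem_toFinset]
  exact mem_or_mem_of_swappable hDD hS hb hc hbc

/-- For every `v ≥ 67` with `v ≡ 7 (mod 12)` there is a
`2-(v,4,1)DD` (with `v(v-1)/6` blocks) whose every defining set contains at
least `(5/8 - 13/(8v) - 21/(2v(v-1)))·(v(v-1)/6)` blocks. -/
theorem stmt9 (v : ℕ) (hv : 67 ≤ v) (hmod : v % 12 = 7) :
    ∃ B : Multiset (List (Fin v)),
      IsDD 2 4 1 B ∧
      (Multiset.card B : ℝ) = (v : ℝ) * ((v : ℝ) - 1) / 6 ∧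
      ∀ S : Multiset (List (Fin v)), IsDefiningSet 2 4 1 B S →
        (5 / 8 - 13 / (8 * (v : ℝ)) - 21 / (2 * (v : ℝ) * ((v : ℝ) - 1)))
            * ((v : ℝ) * ((v : ℝ) - 1) / 6)
          ≤ (Multiset.card S : ℝ) := by
  obtain ⟨q, rfl⟩ : ∃ q, v = 6 * q + 1 := ⟨v / 6, by omega⟩
  obtain ⟨N, h, -, hN⟩ := exists_hasDecomposition (q := q) (by omega)
  obtain ⟨B, hB, hcard, hS⟩ := exists_isDD_of_hasDecomposition h
  have hq : (0 : ℝ) < q := by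
    exact_mod_cast (by omega : 0 < q)
  refine ⟨B, hB, ?_, fun S h_S => ?_⟩
  · have : Multiset.card B = (6 * q + 1) * q := by
      rw [Fintype.card_fin, ← Nat.mul_sub_one, Nat.add_sub_cancel] at hcard
      linarith
    rw [this]
    push_cast
    ring
  · have h1 : (15 * q ^ 2 : ℝ) ≤ 4 * N + 4 * q + 7 := by
      exact_mod_cast hN (by omega)
    have h2 : (N : ℝ) ≤ Multiset.card S := by
      exact_mod_cast hS S h_S
    have h3 : (5 / 8 - 13 / (8 * ((6 * q + 1 : ℕ) : ℝ)) - 21 / (2 * ((6 * q + 1 : ℕ) : ℝ) *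
        (((6 * q + 1 : ℕ) : ℝ) - 1))) * (((6 * q + 1 : ℕ) : ℝ) * (((6 * q + 1 : ℕ) : ℝ) - 1) / 6)
        = (15 * q ^ 2 - 4 * q - 7) / 4 := by
      push_cast
      rw [add_sub_cancel_right]
      field_simp
      ring
    rw [h3]
    linarith
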